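/- In the setting of a topologically mixing countable (or finite) topological Markov shift with big image and preimage property and an invariant Gibbs measure μ for a locally Hölder potential, with α = H₂(μ)/2 > 0: for every ε ∈ (0, α), setting r_n = (log n + log log n)/(α − ε), there is a constant K₁ > 0 such that for all sufficiently large n, μ({x : M_n(x) > r_n}) ≤ K₁/log n. -/

import Mathlib

open MeasureTheory Filter Topology

/-- The one-sided sequence space over the alphabet `I`. -/
abbrev SeqSp (I : Type) : Type := ℕ → I

/-- The left shift map `σ`. -/
def shift {I : Type} : SeqSp I → SeqSp I := fun x n => x (n + 1)

/-- The topological Markov shift `Σ_A` determined by the 0-1 transition matrix `A`. -/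
def SigmaA {I : Type} (A : I → I → Bool) : Set (SeqSp I) :=
  {x | ∀ i : ℕ, A (x i) (x (i + 1)) = true}

/-- The cylinder set (inside `Σ_A`) determined by a finite word `w`. -/
def cyl {I : Type} (A : I → I → Bool) {n : ℕ} (w : Fin n → I) : Set (SeqSp I) :=
  {y | y ∈ SigmaA A ∧ ∀ i : Fin n, y i.val = w i}

/-- The `m`-cylinder containing the point `x`. -/
def cylAt {I : Type} (A : I → I → Bool) (x : SeqSp I) (m : ℕ) : Set (SeqSp I) :=
  {y | y ∈ SigmaA A ∧ ∀ i < m, y i = x i}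

/-- Birkhoff sum `S_m φ = ∑_{i<m} φ ∘ σ^i`. -/
noncomputable def birkhoff {I : Type} (φ : SeqSp I → ℝ) (m : ℕ) (x : SeqSp I) : ℝ :=
  ∑ i ∈ Finset.range m, φ (shift^[i] x)

/-- A potential is locally Hölder: `var_k(φ) ≤ M ζ^k`. -/
def LocallyHolder {I : Type} (A : I → I → Bool) (φ : SeqSp I → ℝ) : Prop :=
  ∃ M > (0 : ℝ), ∃ ζ ∈ Set.Ioo (0 : ℝ) 1, ∀ k ≥ 1, ∀ x ∈ SigmaA A, ∀ y ∈ SigmaA A,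
    (∀ i < k, x i = y i) → |φ x - φ y| ≤ M * ζ ^ k

/-- `μ` is a Gibbs measure for the potential `φ`. -/
def IsGibbs {I : Type} [MeasurableSpace I] (A : I → I → Bool) (φ : SeqSp I → ℝ)
    (μ : Measure (SeqSp I)) : Prop :=
  ∃ c > (0 : ℝ), ∃ P : ℝ, ∀ x ∈ SigmaA A, ∀ m : ℕ,
    c⁻¹ * Real.exp (-(m : ℝ) * P + birkhoff φ m x) ≤ (μ (cylAt A x m)).toReal ∧
    (μ (cylAt A x m)).toReal ≤ c * Real.exp (-(m : ℝ) * P + birkhoff φ m x)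

/-- Topological mixing of the Markov shift. -/
def TopMixing {I : Type} (A : I → I → Bool) : Prop :=
  ∀ a b : I, ∃ n₀ : ℕ, ∀ n > n₀, ∃ x ∈ SigmaA A, x 0 = a ∧ x n = b

/-- The big image and preimage property. -/
def BIP {I : Type} (A : I → I → Bool) : Prop :=
  ∃ S : Finset I, ∀ a : I, ∃ b₁ ∈ S, ∃ b₂ ∈ S, ∃ x ∈ SigmaA A,
    x 0 = b₁ ∧ x 1 = a ∧ x 2 = b₂

/-- Partition function over periodic points: `P_n(φ,a) = ∑_{σ^n x = x, x₀ = a} e^{S_n φ (x)}`. -/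
noncomputable def perSum {I : Type} (A : I → I → Bool) (φ : SeqSp I → ℝ) (n : ℕ) (a : I) : ℝ :=
  ∑' x : {x : SeqSp I // x ∈ SigmaA A ∧ shift^[n] x = x ∧ x 0 = a}, Real.exp (birkhoff φ n x.val)

/-- The Gurevich pressure of `φ` is `PG` (the limit exists and is independent of `a`). -/
def HasGurevichPressure {I : Type} (A : I → I → Bool) (φ : SeqSp I → ℝ) (PG : ℝ) : Prop :=
  ∀ a : I, Tendsto (fun n : ℕ => Real.log (perSum A φ n a) / (n : ℝ)) atTop (nhds PG)

/-- `Z_n(t) = ∑_{C ∈ 𝓒_n} μ(C)^{1+t}`. -/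
noncomputable def Zsum {I : Type} [MeasurableSpace I] (A : I → I → Bool) (μ : Measure (SeqSp I))
    (n : ℕ) (t : ℝ) : ℝ :=
  ∑' w : Fin n → I, (μ (cyl A w)).toReal ^ ((1 : ℝ) + t)

/-- The Rényi entropy of `μ` exists and equals `H₂`. -/
def HasRenyi {I : Type} [MeasurableSpace I] (A : I → I → Bool) (μ : Measure (SeqSp I))
    (H₂ : ℝ) : Prop :=
  Tendsto (fun n : ℕ => Real.log (Zsum A μ n 1) / (-(n : ℝ))) atTop (nhds H₂)

/-- `M_n(x)`: the length of the longest common substring appearing twice in the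
first `n` symbols of `x`. -/
noncomputable def Mn {I : Type} (n : ℕ) (x : SeqSp I) : ℕ :=
  sSup {k : ℕ | ∃ i j : ℕ, i < j ∧ j ≤ n - 1 ∧ ∀ m < k, x (i + m) = x (j + m)}

/-- `ψ`-mixing of `μ` (for cylinders) with rate `ψ`. -/
def PsiMixing {I : Type} [MeasurableSpace I] (A : I → I → Bool) (μ : Measure (SeqSp I))
    (ψ : ℕ → ℝ) : Prop :=
  (∀ k, 0 ≤ ψ k) ∧ (∀ j k, j ≤ k → ψ k ≤ ψ j) ∧
    ∀ n k : ℕ, ∀ w : Fin n → I, ∀ m : ℕ, ∀ v : Fin m → I,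
      |(μ (cyl A w ∩ shift^[n + k] ⁻¹' cyl A v)).toReal -
          (μ (cyl A w)).toReal * (μ (cyl A v)).toReal| ≤
        ψ k * (μ (cyl A w)).toReal * (μ (cyl A v)).toReal

/-- Prepending a symbol to a sequence. -/
def consSeq {I : Type} (a : I) (x : SeqSp I) : SeqSp I := fun n => Nat.casesOn n a x

/-- The Ruelle–Perron–Frobenius transfer operator `𝓛_φ f (x) = ∑_{σ y = x} e^{φ(y)} f(y)`. -/
noncomputable def transferOp {I : Type} (A : I → I → Bool) (φ : SeqSp I → ℝ)
    (f : SeqSp I → ℝ) : SeqSp I → ℝ :=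
  fun x => ∑' a : I, if A a (x 0) = true then Real.exp (φ (consSeq a x)) * f (consSeq a x) else 0

open Classical in
/-- The symbolic metric `d(x,y) = e^{-min{j : x_j ≠ y_j}}`. -/
noncomputable def dS {I : Type} (x y : SeqSp I) : ℝ :=
  if x = y then 0 else Real.exp (-((sInf {j : ℕ | x j ≠ y j} : ℕ) : ℝ))

/-- Sup norm over `Σ_A`. -/
noncomputable def supNormOn {I : Type} (A : I → I → Bool) (f : SeqSp I → ℝ) : ℝ :=
  sSup {c : ℝ | ∃ x ∈ SigmaA A, c = |f x|}

/-- The Lipschitz seminorm `D_β` over the sets `σ[a]`, `a ∈ 𝓘`. -/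
noncomputable def DBeta {I : Type} (A : I → I → Bool) (f : SeqSp I → ℝ) : ℝ :=
  sSup {c : ℝ | ∃ a : I, ∃ x ∈ SigmaA A, ∃ y ∈ SigmaA A,
    A a (x 0) = true ∧ A a (y 0) = true ∧ x ≠ y ∧ c = |f x - f y| / dS x y}

/-- The norm `‖f‖_L = ‖f‖_∞ + D_β f`. -/
noncomputable def normL {I : Type} (A : I → I → Bool) (f : SeqSp I → ℝ) : ℝ :=
  supNormOn A f + DBeta A f

set_option linter.unusedSectionVars false

open scoped ENNReal

/-- The word of the first `n` symbols of `x`, read through the letter map `p`. -/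
def blk {I J : Type} (p : I → J) (n : ℕ) (x : SeqSp I) : Fin n → J := fun i => p (x i)

/-- The largest measure of an admissible cylinder whose image under `p` is the word `W`. -/
noncomputable def maxCyl {I J : Type} [MeasurableSpace I] (A : I → I → Bool)
    (μ : Measure (SeqSp I)) (p : I → J) (n : ℕ) (W : Fin n → J) : ℝ≥0∞ :=
  ⨆ w ∈ {w : SeqSp I | w ∈ SigmaA A ∧ blk p n w = W}, μ (cylAt A w n)

/-- The first `n` symbols of `x` followed by `y`. -/
def splice {I : Type} (n : ℕ) (x y : SeqSp I) : SeqSp I :=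
  fun i => if i < n then x i else y (i - n)

/-- A quasi-Bernoulli invariant measure on `Σ_A`, together with a map `p` from letters to a discrete
alphabet whose fibres are the atoms of the `σ`-algebra on letters. -/
structure QuasiBernoulli {I J : Type} [MeasurableSpace I] [MeasurableSpace J]
    (A : I → I → Bool) (μ : Measure (SeqSp I)) (p : I → J) (C : ℝ≥0∞) : Prop where
  measurable : Measurable p
  saturated : ∀ s : Set I, MeasurableSet s → ∀ a b, p a = p b → a ∈ s → b ∈ s
  supp : μ (SigmaA A) = 1
  inv : MeasurePreserving (shift : SeqSp I → SeqSp I) μ μ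
  ne_top : C ≠ ∞
  upper : ∀ x ∈ SigmaA A, ∀ m n : ℕ,
    μ (cylAt A x (m + n)) ≤ C * (μ (cylAt A x m) * μ (cylAt A (shift^[m] x) n))
  lower : ∀ x ∈ SigmaA A, ∀ m n : ℕ,
    μ (cylAt A x m) * μ (cylAt A (shift^[m] x) n) ≤ C * μ (cylAt A x (m + n))
  pos : ∀ x ∈ SigmaA A, ∀ m : ℕ, 0 < μ (cylAt A x m)

theorem shift_iterate_apply {I : Type} (k : ℕ) (x : SeqSp I) (i : ℕ) :
    (shift^[k] x) i = x (i + k) := by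
  induction k generalizing i with
  | zero => rfl
  | succ k ih =>
    rw [Function.iterate_succ_apply']
    change (shift^[k] x) (i + 1) = _
    rw [ih]
    congr 1
    omega

theorem shift_iterate_mem {I : Type} {A : I → I → Bool} {x : SeqSp I} (hx : x ∈ SigmaA A) (k : ℕ) :
    shift^[k] x ∈ SigmaA A := by
  intro i
  rw [shift_iterate_apply, shift_iterate_apply, show i + 1 + k = i + k + 1 by omega]
  exact hx _

theorem splice_of_lt {I : Type} {n i : ℕ} (h : i < n) (x y : SeqSp I) : splice n x y i = x i :=
  if_pos h

theorem splice_of_le {I : Type} {n i : ℕ} (h : n ≤ i) (x y : SeqSp I) :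
    splice n x y i = y (i - n) :=
  if_neg (by omega)

theorem splice_mem {I : Type} {A : I → I → Bool} {n : ℕ} {x y : SeqSp I}
    (hx : ∀ i, i + 1 < n + 1 → A (x i) (x (i + 1)) = true) (hy : y ∈ SigmaA A)
    (hxy : A (x n) (y 0) = true) : splice (n + 1) x y ∈ SigmaA A := by
  intro i
  rcases lt_trichotomy i n with h | h | h
  · rw [splice_of_lt (by omega), splice_of_lt (by omega)]
    exact hx i (by omega)
  · subst h
    rw [splice_of_lt (by omega), splice_of_le (by omega)]
    simpa using hxy
  · rw [splice_of_le (by omega), splice_of_le (by omega),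
      show i + 1 - (n + 1) = i - (n + 1) + 1 by omega]
    exact hy _

theorem cylAt_congr {I : Type} {A : I → I → Bool} {x y : SeqSp I} {n : ℕ}
    (h : ∀ i < n, x i = y i) : cylAt A x n = cylAt A y n := by
  ext z
  constructor
  · rintro ⟨hz, h'⟩
    exact ⟨hz, fun i hi => (h' i hi).trans (h i hi)⟩
  · rintro ⟨hz, h'⟩
    exact ⟨hz, fun i hi => (h' i hi).trans (h i hi).symm⟩

theorem blk_eq_iff {I J : Type} {p : I → J} {n : ℕ} {x y : SeqSp I} :
    blk p n x = blk p n y ↔ ∀ i < n, p (x i) = p (y i) := by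
  constructor
  · intro h i hi
    exact congrFun h ⟨i, hi⟩
  · intro h
    funext i
    exact h i i.2

theorem blk_eq_add_iff {I J : Type} {p : I → J} {m n : ℕ} {x y : SeqSp I} :
    blk p (m + n) x = blk p (m + n) y ↔
      blk p m x = blk p m y ∧ blk p n (shift^[m] x) = blk p n (shift^[m] y) := by
  simp only [blk_eq_iff, shift_iterate_apply]
  constructor
  · intro h
    exact ⟨fun i hi => h i (by omega), fun i hi => h _ (by omega)⟩
  · rintro ⟨h1, h2⟩ i hi
    rcases lt_or_ge i m with h | h
    · exact h1 i h
    · have := h2 (i - m) (by omega)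
      rwa [Nat.sub_add_cancel h] at this

/-- Measurable sets of sequences only see the atoms of the letters. -/
theorem mem_of_measurableSet_of_saturated {I J : Type} [MeasurableSpace I] {p : I → J}
    (hs : ∀ s : Set I, MeasurableSet s → ∀ a b, p a = p b → a ∈ s → b ∈ s)
    {T : Set (SeqSp I)} (hT : MeasurableSet T) {x y : SeqSp I} (hxy : ∀ i, p (x i) = p (y i)) :
    x ∈ T ↔ y ∈ T := by
  let m : MeasurableSpace (SeqSp I) :=
    { MeasurableSet' := fun T => ∀ x y : SeqSp I, (∀ i, p (x i) = p (y i)) → x ∈ T → y ∈ T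
      measurableSet_empty := by simp
      measurableSet_compl := by
        intro s h x y hxy hx hy
        exact hx (h y x (fun i => (hxy i).symm) hy)
      measurableSet_iUnion := by
        intro f h x y hxy hx
        simp only [Set.mem_iUnion] at hx ⊢
        obtain ⟨i, hi⟩ := hx
        exact ⟨i, h i x y hxy hi⟩ }
  have hle : (MeasurableSpace.pi : MeasurableSpace (SeqSp I)) ≤ m := by
    refine iSup_le fun i => ?_
    rintro _ ⟨s, h, rfl⟩ x y hxy hx
    exact hs s h _ _ (hxy i) hx
  exact ⟨hle T hT x y hxy, hle T hT y x fun i => (hxy i).symm⟩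

namespace QuasiBernoulli

variable {I J : Type} [MeasurableSpace I] [MeasurableSpace J] [DiscreteMeasurableSpace J]
  [Countable J] {A : I → I → Bool} {μ : Measure (SeqSp I)} [IsProbabilityMeasure μ] {p : I → J}
  {C : ℝ≥0∞}

theorem measurable_blk (h : QuasiBernoulli A μ p C) (n : ℕ) : Measurable (blk p n) :=
  measurable_pi_lambda _ fun _ => h.measurable.comp (measurable_pi_apply _)

theorem measure_le_cylAt (h : QuasiBernoulli A μ p C) {x : SeqSp I} (hx : x ∈ SigmaA A) {m : ℕ}
    {E : Set (SeqSp I)} (hE : E ⊆ SigmaA A)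
    (hb : ∀ y ∈ E, blk p (m + 1) y = blk p (m + 1) x ∧ y m = x m) :
    μ E ≤ μ (cylAt A x (m + 1)) := by
  rw [← measure_toMeasurable (cylAt A x (m + 1))]
  refine measure_mono fun y hy => ?_
  obtain ⟨h1, h2⟩ := hb y hy
  have hz : splice (m + 1) x (shift^[m + 1] y) ∈ cylAt A x (m + 1) := by
    refine ⟨splice_mem (fun i _ => hx i) (shift_iterate_mem (hE hy) _) ?_,
      fun i hi => splice_of_lt hi _ _⟩
    rw [shift_iterate_apply, ← h2, zero_add]
    exact hE hy m
  refine (mem_of_measurableSet_of_saturated h.saturated (measurableSet_toMeasurable _ _)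
    fun i => ?_).1 (subset_toMeasurable _ _ hz)
  rcases lt_or_ge i (m + 1) with hi | hi
  · rw [splice_of_lt hi]
    exact (blk_eq_iff.1 h1 i hi).symm
  · rw [splice_of_le hi, shift_iterate_apply, Nat.sub_add_cancel hi]

theorem measure_inter_SigmaA (h : QuasiBernoulli A μ p C) {T : Set (SeqSp I)}
    (hT : MeasurableSet T) : μ (SigmaA A ∩ T) = μ T := by
  refine le_antisymm (measure_mono Set.inter_subset_right) ?_
  have h1 := measure_inter_add_sdiff (μ := μ) (SigmaA A) hT
  have h2 := measure_add_measure_compl (μ := μ) hT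
  rw [measure_univ] at h2
  rw [h.supp] at h1
  have h3 : μ (SigmaA A \ T) ≤ μ Tᶜ := measure_mono fun x hx => hx.2
  have h4 : μ Tᶜ ≠ ∞ := measure_ne_top _ _
  refine ENNReal.le_of_add_le_add_right h4 ?_
  rw [h2, ← h1]
  gcongr

theorem le_maxCyl {x : SeqSp I} (hx : x ∈ SigmaA A) {n : ℕ} {W : Fin n → J}
    (hW : blk p n x = W) : μ (cylAt A x n) ≤ maxCyl A μ p n W :=
  le_iSup₂_of_le x ⟨hx, hW⟩ le_rfl

theorem cylAt_subset_blk (x : SeqSp I) (n : ℕ) : cylAt A x n ⊆ blk p n ⁻¹' {blk p n x} :=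
  fun _ hy => blk_eq_iff.2 fun i hi => congrArg p (hy.2 i hi)

theorem maxCyl_le (n : ℕ) (W : Fin n → J) : maxCyl A μ p n W ≤ μ (blk p n ⁻¹' {W}) := by
  refine iSup₂_le ?_
  rintro w ⟨-, rfl⟩
  exact measure_mono (cylAt_subset_blk w n)

theorem measure_blk_le (h : QuasiBernoulli A μ p C) (x : SeqSp I) (m : ℕ) (S : Finset I)
    (hS : ∀ a, p a = p (x m) → a ∈ S) :
    μ (blk p (m + 1) ⁻¹' {blk p (m + 1) x}) ≤
      S.card * maxCyl A μ p (m + 1) (blk p (m + 1) x) := by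
  rw [← h.measure_inter_SigmaA (h.measurable_blk _ (MeasurableSet.of_discrete))]
  calc _ ≤ μ (⋃ e ∈ S, {y | y ∈ SigmaA A ∧ blk p (m + 1) y = blk p (m + 1) x ∧ y m = e}) := by
        refine measure_mono ?_
        rintro y ⟨hy, hb⟩
        simp only [Set.mem_iUnion]
        exact ⟨y m, hS _ (blk_eq_iff.1 hb m (by omega)), hy, hb, rfl⟩
    _ ≤ ∑ e ∈ S, μ {y | y ∈ SigmaA A ∧ blk p (m + 1) y = blk p (m + 1) x ∧ y m = e} :=
        measure_biUnion_finset_le _ _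
    _ ≤ ∑ e ∈ S, maxCyl A μ p (m + 1) (blk p (m + 1) x) := by
        refine Finset.sum_le_sum fun e _ => ?_
        rcases Set.eq_empty_or_nonempty
          {y | y ∈ SigmaA A ∧ blk p (m + 1) y = blk p (m + 1) x ∧ y m = e} with he | ⟨z, hz⟩
        · rw [he]
          simp
        · refine (h.measure_le_cylAt hz.1 (fun y hy => hy.1) fun y hy => ?_).trans
            (le_maxCyl hz.1 hz.2.1)
          exact ⟨hy.2.1.trans hz.2.1.symm, hy.2.2.trans hz.2.2.symm⟩
    _ = _ := by simp

theorem maxCyl_add_le (h : QuasiBernoulli A μ p C) (x : SeqSp I) (m n : ℕ) :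
    maxCyl A μ p (m + n) (blk p (m + n) x) ≤
      C * (maxCyl A μ p m (blk p m x) * maxCyl A μ p n (blk p n (shift^[m] x))) := by
  refine iSup₂_le ?_
  rintro w ⟨hw, hb⟩
  obtain ⟨h1, h2⟩ := blk_eq_add_iff.1 hb
  refine (h.upper w hw m n).trans ?_
  gcongr
  · exact le_maxCyl hw h1
  · exact le_maxCyl (shift_iterate_mem hw m) h2

/-- A bound on each block cylinder inside a countable union of them. -/
theorem measure_blk_preimage_le (h : QuasiBernoulli A μ p C) {n : ℕ} (V : Set (Fin n → J))
    (ν ν' : Measure (SeqSp I)) (c : ℝ≥0∞)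
    (hV : ∀ x, blk p n x ∈ V →
      ν (blk p n ⁻¹' {blk p n x}) ≤ c * ν' (blk p n ⁻¹' {blk p n x})) :
    ν (blk p n ⁻¹' V) ≤ c * ν' (blk p n ⁻¹' V) := by
  have hm : ∀ y ∈ V, MeasurableSet (blk p n ⁻¹' {y}) :=
    fun y _ => h.measurable_blk n MeasurableSet.of_discrete
  rw [← tsum_measure_preimage_singleton V.to_countable hm,
    ← tsum_measure_preimage_singleton V.to_countable hm, ← ENNReal.tsum_mul_left]
  refine ENNReal.tsum_le_tsum fun W => ?_
  by_cases hW : ∃ x, blk p n x = W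
  · obtain ⟨x, hx⟩ := hW
    rw [← hx]
    exact hV x (hx ▸ W.2)
  · have : blk p n ⁻¹' {(W : Fin n → J)} = ∅ := by
      ext x
      simpa using fun hx => hW ⟨x, hx⟩
    simp [this]

theorem exists_pos_le_cylAt_one (h : QuasiBernoulli A μ p C) (S : Finset I) :
    ∃ δ : ℝ≥0∞, δ ≠ 0 ∧ ∀ z ∈ SigmaA A, z 0 ∈ S → δ ≤ μ (cylAt A z 1) := by
  classical
  induction S using Finset.induction_on with
  | empty => exact ⟨1, one_ne_zero, by simp⟩
  | insert s S _ ih =>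
    obtain ⟨δ, hδ, H⟩ := ih
    by_cases hs : ∃ z ∈ SigmaA A, z 0 = s
    · obtain ⟨z, hz, rfl⟩ := hs
      refine ⟨min δ (μ (cylAt A z 1)), (lt_min hδ.bot_lt (h.pos z hz 1)).ne', fun y hy hyS => ?_⟩
      rcases Finset.mem_insert.1 hyS with h0 | h0
      · rw [cylAt_congr (x := y) (y := z) (n := 1) (fun i hi => by simpa [Nat.lt_one_iff.1 hi])]
        exact min_le_right _ _
      · exact (min_le_left _ _).trans (H y hy h0)
    · refine ⟨δ, hδ, fun y hy hyS => ?_⟩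
      rcases Finset.mem_insert.1 hyS with h0 | h0
      · exact (hs ⟨y, hy, h0⟩).elim
      · exact H y hy h0

theorem cyl_eq_cylAt (x : SeqSp I) (n : ℕ) : cyl A (fun i : Fin n => x i) = cylAt A x n := by
  ext y
  exact and_congr_right fun _ => ⟨fun H i hi => H ⟨i, hi⟩, fun H i => H i i.2⟩

/-- If every letter has a successor in a finite set and some `Z_m` is finite, then the atoms of
the alphabet are finite. -/
theorem finite_fiber (h : QuasiBernoulli A μ p C) {S : Finset I}
    (hS : ∀ a, ∃ z ∈ SigmaA A, z 0 ∈ S ∧ A a (z 0) = true) {m : ℕ}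
    (hZ : ∑' w : Fin (m + 2) → I, μ (cyl A w) ^ 2 ≠ ∞) (j : J) : {a | p a = j}.Finite := by
  have key : ∀ z ∈ SigmaA A, {a | p a = j ∧ A a (z 0) = true}.Finite := by
    intro z hz
    by_contra hinf
    rw [← Set.Infinite, ← Set.infinite_coe_iff] at hinf
    set F : {a | p a = j ∧ A a (z 0) = true} → SeqSp I := fun a => splice 1 (fun _ => a) z with hF
    have hFm : ∀ a, F a ∈ SigmaA A := fun a =>
      splice_mem (n := 0) (fun i hi => by omega) hz a.2.2
    have hF0 : ∀ a, F a 0 = a := fun a => splice_of_lt one_pos _ _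
    have hFs : ∀ a i, F a (i + 1) = z i := fun a i => by
      rw [hF]
      simp only
      rw [splice_of_le (by omega)]
      simp
    obtain ⟨a₀⟩ : Nonempty {a | p a = j ∧ A a (z 0) = true} := inferInstance
    have hle : ∀ a, μ (cylAt A (F a₀) (m + 2)) ≤ μ (cylAt A (F a) (m + 2)) := by
      intro a
      refine h.measure_le_cylAt (hFm a) (fun y hy => hy.1) fun y hy => ⟨?_, ?_⟩
      · refine blk_eq_iff.2 fun i hi => ?_
        rw [hy.2 i hi]
        cases i with
        | zero => rw [hF0, hF0, a.2.1, a₀.2.1]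
        | succ i => rw [hFs, hFs]
      · rw [hy.2 _ (by omega), hFs, hFs]
    refine hZ (top_unique ?_)
    calc (∞ : ℝ≥0∞)
        = ∑' _ : {a | p a = j ∧ A a (z 0) = true}, μ (cylAt A (F a₀) (m + 2)) ^ 2 :=
          (ENNReal.tsum_const_eq_top_of_ne_zero
            (pow_ne_zero _ (h.pos _ (hFm a₀) _).ne')).symm
      _ ≤ ∑' a, μ (cyl A (fun i : Fin (m + 2) => F a i)) ^ 2 := by
          refine ENNReal.tsum_le_tsum fun a => ?_
          rw [cyl_eq_cylAt]
          exact pow_le_pow_left' (hle a) 2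
      _ ≤ _ := by
          refine ENNReal.tsum_comp_le_tsum_of_injective
            (f := fun a (i : Fin (m + 2)) => F a i) (fun a b hab => ?_)
            fun w => μ (cyl A w) ^ 2
          have := congrFun hab 0
          simp only [Fin.val_zero, hF0] at this
          exact Subtype.ext this
  refine (S.finite_toSet.biUnion
    (t := fun s => {a | p a = j ∧ A a s = true ∧ ∃ z ∈ SigmaA A, z 0 = s}) fun s _ => ?_).subset ?_
  · by_cases hs : ∃ z ∈ SigmaA A, z 0 = s
    · obtain ⟨z, hz, rfl⟩ := hs
      exact (key z hz).subset fun a ha => ⟨ha.1, ha.2.1⟩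
    · refine Set.finite_empty.subset fun a ha => (hs ha.2.2).elim
  · intro a ha
    obtain ⟨z, hz, hzS, haz⟩ := hS a
    simp only [Set.mem_iUnion]
    exact ⟨z 0, hzS, ha, haz, z, hz, rfl⟩

theorem exists_maxCyl_le_hit (h : QuasiBernoulli A μ p C) {S : Finset I}
    (hS : ∀ a, ∃ z ∈ SigmaA A, z 0 ∈ S ∧ A a (z 0) = true) :
    ∃ K : ℝ≥0∞, K ≠ ∞ ∧ ∀ (n : ℕ) (W : Fin (n + 1) → J), maxCyl A μ p (n + 1) W ≤
      K * μ (blk p (n + 1) ⁻¹' {W} ∩ {y | p (y (n + 1)) ∈ p '' S}) := by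
  obtain ⟨δ, hδ, H⟩ := h.exists_pos_le_cylAt_one S
  refine ⟨C / δ, ENNReal.div_ne_top h.ne_top hδ, fun n W => iSup₂_le ?_⟩
  rintro w ⟨hw, rfl⟩
  obtain ⟨y, hy, hyS, hwy⟩ := hS (w n)
  set z := splice (n + 1) w y
  have hz : z ∈ SigmaA A := splice_mem (fun i _ => hw i) hy hwy
  have hzw : ∀ i < n + 1, z i = w i := fun i hi => splice_of_lt hi _ _
  have hz0 : z (n + 1) = y 0 := by
    change splice (n + 1) w y (n + 1) = y 0
    rw [splice_of_le le_rfl, Nat.sub_self]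
  have hδ' : δ ≤ μ (cylAt A (shift^[n + 1] z) 1) := by
    refine H _ (shift_iterate_mem hz _) ?_
    rwa [shift_iterate_apply, zero_add, hz0]
  have hle : μ (cylAt A w (n + 1)) * δ ≤ C * μ (cylAt A z (n + 1 + 1)) := by
    rw [← cylAt_congr hzw]
    exact (mul_le_mul_right hδ' _).trans (h.lower z hz (n + 1) 1)
  have hsub : cylAt A z (n + 1 + 1) ⊆
      blk p (n + 1) ⁻¹' {blk p (n + 1) w} ∩ {y | p (y (n + 1)) ∈ p '' S} := by
    intro v hv
    refine ⟨blk_eq_iff.2 fun i hi => ?_, ?_⟩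
    · rw [hv.2 i (by omega), hzw i hi]
    · change p (v (n + 1)) ∈ p '' S
      rw [hv.2 _ (by omega), hz0]
      exact ⟨_, hyS, rfl⟩
  have hδt : δ ≠ ∞ := ne_top_of_le_ne_top (measure_ne_top _ _) hδ'
  rw [← ENNReal.mul_div_right_comm, ENNReal.le_div_iff_mul_le (Or.inl hδ) (Or.inl hδt)]
  exact hle.trans (by gcongr)

theorem measurableSet_apply_mem (h : QuasiBernoulli A μ p C) (i : ℕ) (T : Set J) :
    MeasurableSet {y : SeqSp I | p (y i) ∈ T} :=
  (h.measurable.comp (measurable_pi_apply i)) MeasurableSet.of_discrete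

/-- Almost every sequence visits the atom of one of the letters of `S`. -/
theorem measure_never_hit (h : QuasiBernoulli A μ p C) {S : Finset I}
    (hS : ∀ a, ∃ z ∈ SigmaA A, z 0 ∈ S ∧ A a (z 0) = true)
    (hfin : ∀ j, {a | p a = j}.Finite) : μ {y | ∀ i, p (y i) ∉ p '' S} = 0 := by
  obtain ⟨K, hK, hit⟩ := h.exists_maxCyl_le_hit hS
  set H : Set (SeqSp I) := {y | ∀ i, p (y i) ∉ p '' S} with hH
  have hHm : MeasurableSet H := by
    rw [hH, Set.ofPred_forall]
    exact MeasurableSet.iInter fun i => h.measurableSet_apply_mem i (p '' S)ᶜ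
  set N : J → ℕ := fun j => (hfin j).toFinset.card
  set D : ℕ → Set (SeqSp I) := fun m =>
    {y | p (y (m + 1)) ∈ p '' S} ∩ {y | ∀ i ≤ m, p (y i) ∉ p '' S} with hD
  have hDm : ∀ m, MeasurableSet (D m) := fun m => by
    refine (h.measurableSet_apply_mem _ _).inter ?_
    simp only [Set.ofPred_forall]
    exact MeasurableSet.iInter fun i => MeasurableSet.iInter fun _ =>
      h.measurableSet_apply_mem i (p '' S)ᶜ
  have hDd : Pairwise (Function.onFun Disjoint D) := by
    rw [pairwise_disjoint_on]
    exact fun m n hmn => Set.disjoint_left.2 fun y hy hy' => hy'.2 (m + 1) hmn hy.1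
  have hDt : Tendsto (fun m => μ (D m)) atTop (𝓝 0) := by
    refine ENNReal.tendsto_atTop_zero_of_tsum_ne_top ?_
    rw [← measure_iUnion hDd hDm]
    exact measure_ne_top _ _
  have hM : ∀ M : ℕ, μ (H ∩ {y | N (p (y 0)) ≤ M}) = 0 := by
    intro M
    have hbound : ∀ m, μ (H ∩ {y | N (p (y 0)) ≤ M}) ≤ M * K * μ (D m) := by
      intro m
      have hinv := h.inv.iterate m
      have hHs : H ⊆ shift^[m] ⁻¹' H := fun y hy i => by
        rw [shift_iterate_apply]
        exact hy _
      have hHH : μ (shift^[m] ⁻¹' H \ H) = 0 := by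
        rw [measure_sdiff hHs hHm.nullMeasurableSet (measure_ne_top _ _),
          hinv.measure_preimage hHm.nullMeasurableSet, tsub_self]
      have hGm : MeasurableSet (H ∩ {y | N (p (y 0)) ≤ M}) :=
        hHm.inter (h.measurableSet_apply_mem 0 {j | N j ≤ M})
      rw [← hinv.measure_preimage hGm.nullMeasurableSet]
      set V : Set (Fin (m + 1) → J) :=
        {W | (∀ i, W i ∉ p '' S) ∧ N (W (Fin.last m)) ≤ M} with hV
      calc _ ≤ μ (blk p (m + 1) ⁻¹' V ∪ shift^[m] ⁻¹' H \ H) := by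
            refine measure_mono fun y hy => ?_
            by_cases hyH : y ∈ H
            · refine Or.inl ⟨fun i => hyH i, ?_⟩
              have := hy.2
              simpa [shift_iterate_apply, blk] using this
            · exact Or.inr ⟨hy.1, hyH⟩
        _ ≤ μ (blk p (m + 1) ⁻¹' V) := by
            refine (measure_union_le _ _).trans ?_
            rw [hHH, add_zero]
        _ ≤ M * K * μ.restrict {y | p (y (m + 1)) ∈ p '' S} (blk p (m + 1) ⁻¹' V) := by
            refine h.measure_blk_preimage_le V _ _ _ fun x hx => ?_
            refine (h.measure_blk_le x m (hfin (p (x m))).toFinset (by simp)).trans ?_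
            rw [Measure.restrict_apply (h.measurable_blk _ MeasurableSet.of_discrete), mul_assoc]
            refine mul_le_mul' ?_ (hit m _)
            exact_mod_cast hx.2
        _ ≤ M * K * μ (D m) := by
            rw [Measure.restrict_apply (h.measurable_blk _ MeasurableSet.of_discrete)]
            gcongr
            rintro y ⟨hy, hy'⟩
            exact ⟨hy', fun i hi => hy.1 ⟨i, by omega⟩⟩
    have hlim : Tendsto (fun m => M * K * μ (D m)) atTop (𝓝 0) := by
      have := ENNReal.Tendsto.const_mul (a := M * K) hDt
        (Or.inr (ENNReal.mul_ne_top (ENNReal.natCast_ne_top M) hK))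
      rwa [mul_zero] at this
    exact le_antisymm (ge_of_tendsto' hlim hbound) bot_le
  refine measure_mono_null (t := ⋃ M : ℕ, H ∩ {y | N (p (y 0)) ≤ M}) (fun y hy => ?_)
    (measure_iUnion_null hM)
  exact Set.mem_iUnion.2 ⟨N (p (y 0)), hy, le_refl (N (p (y 0)))⟩

theorem measure_shift_iterate_preimage (h : QuasiBernoulli A μ p C) (k : ℕ) {T : Set (SeqSp I)}
    (hT : MeasurableSet T) : μ (shift^[k] ⁻¹' T) = μ T :=
  (h.inv.iterate k).measure_preimage hT.nullMeasurableSet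

theorem exists_measure_blk_inter_le (h : QuasiBernoulli A μ p C) {S : Finset I}
    (hS : ∀ a, ∃ z ∈ SigmaA A, z 0 ∈ S ∧ A a (z 0) = true)
    (hfin : ∀ j, {a | p a = j}.Finite) :
    ∃ K : ℝ≥0∞, K ≠ ∞ ∧ ∀ (x : SeqSp I) (k l : ℕ) (V : Set (Fin l → J)),
      μ (blk p k ⁻¹' {blk p k x} ∩ shift^[k] ⁻¹' (blk p l ⁻¹' V)) ≤
        K * maxCyl A μ p k (blk p k x) * μ (blk p l ⁻¹' V) := by
  classical
  set F : Finset I := S.biUnion fun s => (hfin (p s)).toFinset with hF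
  refine ⟨F.card * C, ENNReal.mul_ne_top (ENNReal.natCast_ne_top _) h.ne_top, fun x k l V => ?_⟩
  set c := F.card * C * maxCyl A μ p k (blk p k x) with hc
  set B := blk p k ⁻¹' {blk p k x} with hB
  have hBm : MeasurableSet B := h.measurable_blk _ MeasurableSet.of_discrete
  have hsh : ∀ n, Measurable (shift^[n] : SeqSp I → SeqSp I) := fun n => (h.inv.iterate n).measurable
  set V' : (t : ℕ) → Set (Fin (l + t + 1) → J) := fun t =>
    {W | (fun i : Fin l => W ⟨i, by omega⟩) ∈ V ∧ W (Fin.last _) ∈ p '' S ∧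
      ∀ i (hi : i < t), W ⟨l + i, by omega⟩ ∉ p '' S} with hV'
  have hV'm : ∀ t, MeasurableSet (blk p (l + t + 1) ⁻¹' V' t) :=
    fun t => h.measurable_blk _ MeasurableSet.of_discrete
  have hmem : ∀ t y, y ∈ blk p (l + t + 1) ⁻¹' V' t ↔ y ∈ blk p l ⁻¹' V ∧
      p (y (l + t)) ∈ p '' S ∧ ∀ i < t, p (y (l + i)) ∉ p '' S := fun t y => Iff.rfl
  have hV'sub : ∀ t, blk p (l + t + 1) ⁻¹' V' t ⊆ blk p l ⁻¹' V := fun t y hy =>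
    ((hmem t y).1 hy).1
  have hV'd : Pairwise (Function.onFun Disjoint fun t => blk p (l + t + 1) ⁻¹' V' t) := by
    rw [pairwise_disjoint_on]
    refine fun s t hst => Set.disjoint_left.2 fun y hy hy' => ?_
    exact ((hmem t y).1 hy').2.2 s hst ((hmem s y).1 hy).2.1
  have hone : ∀ t, μ (B ∩ shift^[k] ⁻¹' (blk p (l + t + 1) ⁻¹' V' t)) ≤
      c * μ (blk p (l + t + 1) ⁻¹' V' t) := by
    intro t
    have := h.measure_blk_preimage_le (V' t) ((μ.restrict B).map shift^[k]) μ c fun y hy => ?_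
    · rwa [Measure.map_apply (hsh k) (hV'm t), Measure.restrict_apply (hsh k (hV'm t)),
        Set.inter_comm] at this
    have hyb : MeasurableSet (blk p (l + t + 1) ⁻¹' {blk p (l + t + 1) y}) :=
      h.measurable_blk _ MeasurableSet.of_discrete
    rw [Measure.map_apply (hsh k) hyb, Measure.restrict_apply (hsh k hyb)]
    rcases Set.eq_empty_or_nonempty
      (shift^[k] ⁻¹' (blk p (l + t + 1) ⁻¹' {blk p (l + t + 1) y}) ∩ B) with he | ⟨v, hv, hvB⟩
    · rw [he]
      simp
    have hv' : blk p (l + t + 1) (shift^[k] v) = blk p (l + t + 1) y := hv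
    have hvx : blk p k v = blk p k x := hvB
    have hlast : p (v (k + (l + t))) ∈ p '' S := by
      have h1 : p (y (l + t)) ∈ p '' S := ((hmem t y).1 hy).2.1
      rw [← blk_eq_iff.1 hv' (l + t) (by omega), shift_iterate_apply] at h1
      rwa [add_comm k]
    calc _ ≤ μ (blk p (k + (l + t) + 1) ⁻¹' {blk p (k + (l + t) + 1) v}) := by
          refine measure_mono fun u hu => ?_
          refine (blk_eq_add_iff (m := k) (n := l + t + 1)).2 ⟨?_, ?_⟩
          · exact Eq.trans hu.2 hvx.symm
          · exact Eq.trans hu.1 hv'.symm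
      _ ≤ F.card * maxCyl A μ p (k + (l + t) + 1) (blk p (k + (l + t) + 1) v) := by
          refine h.measure_blk_le v _ F fun a ha => ?_
          obtain ⟨s, hs, hsv⟩ := hlast
          rw [hF, Finset.mem_biUnion]
          exact ⟨s, hs, by simp [ha, hsv]⟩
      _ ≤ F.card * (C * (maxCyl A μ p k (blk p k v) *
            maxCyl A μ p (l + t + 1) (blk p (l + t + 1) (shift^[k] v)))) := by
          gcongr
          exact h.maxCyl_add_le v k (l + t + 1)
      _ ≤ c * μ (blk p (l + t + 1) ⁻¹' {blk p (l + t + 1) y}) := by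
          rw [hvx, hv', hc, mul_assoc, mul_assoc]
          gcongr
          exact maxCyl_le _ _
  set H : Set (SeqSp I) := {y | ∀ i, p (y i) ∉ p '' S} with hH
  have hH0 : μ (shift^[k] ⁻¹' (shift^[l] ⁻¹' H)) = 0 := by
    have hHm : MeasurableSet H := by
      rw [hH, Set.ofPred_forall]
      exact MeasurableSet.iInter fun i => h.measurableSet_apply_mem i (p '' S)ᶜ
    rw [h.measure_shift_iterate_preimage k (hsh l hHm), h.measure_shift_iterate_preimage l hHm]
    exact h.measure_never_hit hS hfin
  calc _ ≤ μ ((⋃ t, B ∩ shift^[k] ⁻¹' (blk p (l + t + 1) ⁻¹' V' t)) ∪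
          shift^[k] ⁻¹' (shift^[l] ⁻¹' H)) := by
        refine measure_mono fun y hy => ?_
        by_cases hex : ∃ t, p (shift^[k] y (l + t)) ∈ p '' S
        · refine Or.inl (Set.mem_iUnion.2 ⟨Nat.find hex, hy.1, ?_⟩)
          exact (hmem _ _).2 ⟨hy.2, Nat.find_spec hex, fun i hi => Nat.find_min hex hi⟩
        · refine Or.inr fun i hi => hex ⟨i, ?_⟩
          rwa [shift_iterate_apply, add_comm] at hi
    _ ≤ ∑' t, μ (B ∩ shift^[k] ⁻¹' (blk p (l + t + 1) ⁻¹' V' t)) := by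
        refine (measure_union_le _ _).trans ?_
        rw [hH0, add_zero]
        exact measure_iUnion_le _
    _ ≤ ∑' t, c * μ (blk p (l + t + 1) ⁻¹' V' t) := ENNReal.tsum_le_tsum hone
    _ ≤ c * μ (blk p l ⁻¹' V) := by
        rw [ENNReal.tsum_mul_left, ← measure_iUnion hV'd hV'm]
        gcongr
        exact Set.iUnion_subset hV'sub

theorem tsum_maxCyl_sq_le (n : ℕ) :
    ∑' W : Fin n → J, maxCyl A μ p n W ^ 2 ≤ ∑' w : Fin n → I, μ (cyl A w) ^ 2 := by
  rw [← ENNReal.tsum_fiberwise (fun w : Fin n → I => μ (cyl A w) ^ 2)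
    (fun w : Fin n → I => fun i => p (w i))]
  refine ENNReal.tsum_le_tsum fun W => ?_
  rw [← ENNReal.rpow_ofNat, ← ENNReal.le_rpow_inv_iff (by norm_num)]
  refine iSup₂_le ?_
  rintro x ⟨-, hx⟩
  rw [ENNReal.le_rpow_inv_iff (by norm_num), ENNReal.rpow_ofNat, ← cyl_eq_cylAt]
  exact ENNReal.le_tsum (f := fun w : (fun w : Fin n → I => fun i => p (w i)) ⁻¹' {W} =>
    μ (cyl A (w : Fin n → I)) ^ 2) ⟨fun i => x i, hx⟩

/-- The sequences in which a block of length `k` recurs at distance `d`, up to atoms. -/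
theorem exists_measure_match_le (h : QuasiBernoulli A μ p C) {S : Finset I}
    (hS : ∀ a, ∃ z ∈ SigmaA A, z 0 ∈ S ∧ A a (z 0) = true)
    (hfin : ∀ j, {a | p a = j}.Finite) :
    ∃ K : ℝ≥0∞, K ≠ ∞ ∧ ∀ k d, k ≤ d → ∀ i,
      μ {y | ∀ m < k, p (y (i + m)) = p (y (i + d + m))} ≤
        K * ∑' w : Fin k → I, μ (cyl A w) ^ 2 := by
  obtain ⟨K, hK, hdec⟩ := h.exists_measure_blk_inter_le hS hfin
  refine ⟨K * K, ENNReal.mul_ne_top hK hK, fun k d hkd i => ?_⟩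
  obtain ⟨e, rfl⟩ := Nat.exists_eq_add_of_le hkd
  set T : (Fin k → J) → Set (SeqSp I) := fun W =>
    blk p k ⁻¹' {W} ∩ shift^[k] ⁻¹' (shift^[e] ⁻¹' (blk p k ⁻¹' {W})) with hT
  have hbm : ∀ W, MeasurableSet (blk p k ⁻¹' {W}) :=
    fun W => h.measurable_blk _ MeasurableSet.of_discrete
  have hsh : ∀ n, Measurable (shift^[n] : SeqSp I → SeqSp I) := fun n => (h.inv.iterate n).measurable
  have hTle : ∀ W, μ (T W) ≤ K * K * maxCyl A μ p k W ^ 2 := by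
    intro W
    by_cases hW : ∃ x, blk p k x = W
    · obtain ⟨x, rfl⟩ := hW
      have h1 := hdec x k (e + k) {U | (fun i : Fin k => U ⟨e + i, by omega⟩) = blk p k x}
      have h2 := hdec x k 0 Set.univ
      have hset : blk p (e + k) ⁻¹' {U | (fun i : Fin k => U ⟨e + i, by omega⟩) = blk p k x} =
          shift^[e] ⁻¹' (blk p k ⁻¹' {blk p k x}) := by
        ext y
        change (fun i : Fin k => p (y (e + i))) = blk p k x ↔ blk p k (shift^[e] y) = blk p k x
        have : blk p k (shift^[e] y) = fun i : Fin k => p (y (e + i)) := by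
          funext i
          simp [blk, shift_iterate_apply, add_comm]
        rw [this]
      rw [hset, h.measure_shift_iterate_preimage e (hbm _)] at h1
      simp only [Set.preimage_univ, Set.inter_univ, measure_univ, mul_one] at h2
      calc μ (T (blk p k x)) ≤ K * maxCyl A μ p k (blk p k x) *
            (K * maxCyl A μ p k (blk p k x)) := h1.trans (mul_le_mul_right h2 _)
        _ = _ := by ring
    · have : T W = ∅ := by
        ext y
        exact ⟨fun hy => hW ⟨y, hy.1⟩, fun hy => hy.elim⟩
      rw [this]
      simp
  calc _ ≤ μ (shift^[i] ⁻¹' ⋃ W, T W) := by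
        refine measure_mono fun y hy => Set.mem_iUnion.2 ⟨blk p k (shift^[i] y), rfl, ?_⟩
        refine blk_eq_iff.2 fun m hm => ?_
        simp only [shift_iterate_apply]
        rw [show m + i = i + m by omega, hy m hm]
        congr 2
        omega
    _ = μ (⋃ W, T W) := h.measure_shift_iterate_preimage i
        (MeasurableSet.iUnion fun W => (hbm W).inter (hsh k (hsh e (hbm W))))
    _ ≤ ∑' W, μ (T W) := measure_iUnion_le _
    _ ≤ ∑' W, K * K * maxCyl A μ p k W ^ 2 := ENNReal.tsum_le_tsum hTle
    _ ≤ _ := by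
        rw [ENNReal.tsum_mul_left]
        gcongr
        exact tsum_maxCyl_sq_le k

end QuasiBernoulli

theorem IsGibbs.exists_quasiBernoulli {I : Type} [Countable I] [MeasurableSpace I]
    {A : I → I → Bool} {φ : SeqSp I → ℝ} {μ : Measure (SeqSp I)} [IsProbabilityMeasure μ]
    (hgibbs : IsGibbs A φ μ) (hinv : MeasurePreserving (shift : SeqSp I → SeqSp I) μ μ)
    (hsupp : μ (SigmaA A) = 1) :
    ∃ (J : Type) (_ : MeasurableSpace J) (_ : DiscreteMeasurableSpace J) (_ : Countable J)
      (p : I → J) (C : ℝ≥0∞), QuasiBernoulli A μ p C := by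
  obtain ⟨c, hc, P, hG⟩ := hgibbs
  let p : I → Quotient (Setoid.ker (measurableAtom : I → Set I)) := Quotient.mk _
  have hp : ∀ a b, p a = p b ↔ measurableAtom a = measurableAtom b := fun a b => Quotient.eq
  have hpre : ∀ T, MeasurableSet (p ⁻¹' T) := by
    intro T
    have : p ⁻¹' T = ⋃ a ∈ p ⁻¹' T, measurableAtom a := by
      ext b
      simp only [Set.mem_iUnion]
      refine ⟨fun hb => ⟨b, hb, mem_measurableAtom_self b⟩, ?_⟩
      rintro ⟨a, ha, hb⟩
      have : p b = p a := (hp b a).2 (measurableAtom_eq_of_mem hb)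
      rw [Set.mem_preimage, this]
      exact ha
    rw [this]
    exact MeasurableSet.biUnion (Set.to_countable _) fun a _ =>
      MeasurableSet.measurableAtom_of_countable a
  have hbirk : ∀ (x : SeqSp I) (m n : ℕ),
      Real.exp (-((m + n : ℕ) : ℝ) * P + birkhoff φ (m + n) x) =
        Real.exp (-(m : ℝ) * P + birkhoff φ m x) *
          Real.exp (-(n : ℝ) * P + birkhoff φ n (shift^[m] x)) := by
    intro x m n
    rw [← Real.exp_add]
    congr 1
    simp only [birkhoff, Finset.sum_range_add, ← Function.iterate_add_apply, add_comm _ m]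
    push_cast
    ring
  have hof : ∀ s : Set (SeqSp I), μ s = ENNReal.ofReal (μ s).toReal := fun s =>
    (ENNReal.ofReal_toReal (measure_ne_top _ _)).symm
  have hle : ∀ x ∈ SigmaA A, ∀ m : ℕ,
      Real.exp (-(m : ℝ) * P + birkhoff φ m x) ≤ c * (μ (cylAt A x m)).toReal := by
    intro x hx m
    calc _ = c * (c⁻¹ * Real.exp (-(m : ℝ) * P + birkhoff φ m x)) := by field_simp
      _ ≤ _ := by
        gcongr
        exact (hG x hx m).1
  refine ⟨_, inferInstance, ⟨fun T => hpre T⟩, inferInstance, p, ENNReal.ofReal (c ^ 3),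
    ⟨fun T _ => hpre T, ?_, hsupp, hinv, ENNReal.ofReal_ne_top, ?_, ?_, ?_⟩⟩
  · intro s hs a b hab ha
    refine mem_of_mem_measurableAtom (x := a) ?_ hs ha
    rw [(hp a b).1 hab]
    exact mem_measurableAtom_self b
  · intro x hx m n
    rw [hof (cylAt A x (m + n)), hof (cylAt A x m), hof (cylAt A (shift^[m] x) n),
      ← ENNReal.ofReal_mul ENNReal.toReal_nonneg, ← ENNReal.ofReal_mul (by positivity)]
    refine ENNReal.ofReal_le_ofReal ?_
    calc _ ≤ _ := (hG x hx (m + n)).2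
      _ ≤ c * ((c * (μ (cylAt A x m)).toReal) * (c * (μ (cylAt A (shift^[m] x) n)).toReal)) := by
        rw [hbirk]
        gcongr
        · exact hle x hx m
        · exact hle _ (shift_iterate_mem hx m) n
      _ = _ := by ring
  · intro x hx m n
    rw [hof (cylAt A x (m + n)), hof (cylAt A x m), hof (cylAt A (shift^[m] x) n),
      ← ENNReal.ofReal_mul ENNReal.toReal_nonneg, ← ENNReal.ofReal_mul (by positivity)]
    refine ENNReal.ofReal_le_ofReal ?_
    calc _ ≤ (c * Real.exp (-(m : ℝ) * P + birkhoff φ m x)) *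
          (c * Real.exp (-(n : ℝ) * P + birkhoff φ n (shift^[m] x))) := by
          gcongr
          · exact (hG x hx m).2
          · exact (hG _ (shift_iterate_mem hx m) n).2
      _ = c ^ 2 * Real.exp (-((m + n : ℕ) : ℝ) * P + birkhoff φ (m + n) x) := by
          rw [hbirk]
          ring
      _ ≤ c ^ 2 * (c * (μ (cylAt A x (m + n))).toReal) := by
          gcongr
          exact hle x hx _
      _ = _ := by ring
  · intro x hx m
    refine pos_iff_ne_zero.2 fun h0 => ?_
    have := (hG x hx m).1
    rw [h0, ENNReal.toReal_zero] at this
    exact absurd this (not_le.2 (by positivity))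

theorem HasRenyi.eventually_tsum_le {I : Type} [MeasurableSpace I] {A : I → I → Bool}
    {μ : Measure (SeqSp I)} [IsProbabilityMeasure μ] {H₂ : ℝ} (hH₂ : HasRenyi A μ H₂) {h : ℝ}
    (h0 : 0 ≤ h) (hlt : h < H₂) :
    ∀ᶠ k : ℕ in atTop, ∑' w : Fin k → I, μ (cyl A w) ^ 2 ≤
      ENNReal.ofReal (Real.exp (-(k * h))) := by
  filter_upwards [hH₂.eventually_const_lt hlt, eventually_gt_atTop 0] with k hk hk0
  have hk0' : (0 : ℝ) < k := by exact_mod_cast hk0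
  rw [div_neg, lt_neg, div_lt_iff₀ hk0'] at hk
  have hlog : Real.log (Zsum A μ k 1) < -(k * h) := by linarith
  have hneg : Real.log (Zsum A μ k 1) < 0 := by
    have := mul_nonneg hk0'.le h0
    linarith
  have hZne : Zsum A μ k 1 ≠ 0 := by
    intro hz
    rw [hz, Real.log_zero] at hneg
    exact lt_irrefl _ hneg
  have hnn : ∀ w : Fin k → I, 0 ≤ (μ (cyl A w)).toReal ^ ((1 : ℝ) + 1) := fun w => by positivity
  have hsum : Summable fun w : Fin k → I => (μ (cyl A w)).toReal ^ ((1 : ℝ) + 1) := by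
    by_contra hns
    exact hZne (tsum_eq_zero_of_not_summable hns)
  have hZpos : 0 < Zsum A μ k 1 := lt_of_le_of_ne (tsum_nonneg hnn) hZne.symm
  have heq : ∑' w : Fin k → I, μ (cyl A w) ^ 2 = ENNReal.ofReal (Zsum A μ k 1) := by
    rw [Zsum, ENNReal.ofReal_tsum_of_nonneg hnn hsum]
    refine tsum_congr fun w => ?_
    rw [show (1 : ℝ) + 1 = (2 : ℕ) by norm_num, Real.rpow_natCast,
      ENNReal.ofReal_pow ENNReal.toReal_nonneg, ENNReal.ofReal_toReal (measure_ne_top _ _)]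
  rw [heq]
  exact ENNReal.ofReal_le_ofReal ((Real.log_lt_iff_lt_exp hZpos).1 hlog).le

/-- A long match either does not overlap itself, or forces, by periodicity, a non-overlapping match
of half its length. -/
theorem exists_match_of_le_Mn {I : Type} {k n : ℕ} {x : SeqSp I} (hk0 : 0 < k) (hk : k ≤ Mn n x) :
    ∃ i < n, (∃ d < n, k ≤ d ∧ ∀ m < k, x (i + m) = x (i + d + m)) ∨
      ∃ d < 2 * k + 1, (k + 1) / 2 ≤ d ∧ ∀ m < (k + 1) / 2, x (i + m) = x (i + d + m) := by
  have hmem : Mn n x ∈ {k : ℕ | ∃ i j : ℕ, i < j ∧ j ≤ n - 1 ∧ ∀ m < k, x (i + m) = x (j + m)} := by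
    refine Nat.sSup_mem ?_ ?_
    · by_contra hne
      rw [Set.not_nonempty_iff_eq_empty] at hne
      rw [Mn, hne, csSup_empty] at hk
      exact absurd (Nat.le_zero.1 hk) hk0.ne'
    · by_contra hbdd
      rw [Mn, Nat.sSup_of_not_bddAbove hbdd] at hk
      omega
  obtain ⟨i, j, hij, hjn, hm⟩ := hmem
  obtain ⟨g, rfl⟩ := Nat.exists_eq_add_of_lt hij
  refine ⟨i, by omega, ?_⟩
  rcases le_or_gt k (g + 1) with hg | hg
  · refine Or.inl ⟨g + 1, by omega, hg, fun m hmk => ?_⟩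
    rw [hm m (by omega), add_assoc i g 1]
  · right
    have hper : ∀ t m, m + t * (g + 1) < k + (g + 1) → x (i + m) = x (i + t * (g + 1) + m) := by
      intro t
      induction t with
      | zero => simp
      | succ t ih =>
        intro m hmt
        rw [add_mul, one_mul] at hmt ⊢
        rw [ih m (by omega), add_assoc i, hm _ (by omega)]
        congr 1
        omega
    set l := (k + 1) / 2 with hl
    have hdiv := Nat.div_add_mod (l + g) (g + 1)
    have hmod := Nat.mod_lt (l + g) (show 0 < g + 1 by omega)
    rw [mul_comm] at hdiv
    exact ⟨(l + g) / (g + 1) * (g + 1), by omega, by omega,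
      fun m hml => hper _ m (by omega)⟩

theorem QuasiBernoulli.exists_measure_le_Mn {I J : Type} [MeasurableSpace I] [MeasurableSpace J]
    [DiscreteMeasurableSpace J] [Countable J] {A : I → I → Bool} {μ : Measure (SeqSp I)}
    [IsProbabilityMeasure μ] {p : I → J} {C : ℝ≥0∞} (h : QuasiBernoulli A μ p C) {S : Finset I}
    (hS : ∀ a, ∃ z ∈ SigmaA A, z 0 ∈ S ∧ A a (z 0) = true)
    (hfin : ∀ j, {a | p a = j}.Finite) :
    ∃ K : ℝ≥0∞, K ≠ ∞ ∧ ∀ n k, 0 < k → μ {x | k ≤ Mn n x} ≤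
      n * (n * (K * ∑' w : Fin k → I, μ (cyl A w) ^ 2)) +
      n * ((2 * k + 1 : ℕ) * (K * ∑' w : Fin ((k + 1) / 2) → I, μ (cyl A w) ^ 2)) := by
  obtain ⟨K, hK, hmatch⟩ := h.exists_measure_match_le hS hfin
  refine ⟨K, hK, fun n k hk => ?_⟩
  have hunion : ∀ N L, μ (⋃ i ∈ Finset.range n, ⋃ d ∈ Finset.range N,
      {y | L ≤ d ∧ ∀ m < L, p (y (i + m)) = p (y (i + d + m))}) ≤
      n * (N * (K * ∑' w : Fin L → I, μ (cyl A w) ^ 2)) := by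
    intro N L
    have hcard : ∀ (N : ℕ) (a : ℝ≥0∞), ∑ _ ∈ Finset.range N, a = N * a := by simp
    rw [← hcard n, ← hcard N]
    refine (measure_biUnion_finset_le _ _).trans (Finset.sum_le_sum fun i _ => ?_)
    refine (measure_biUnion_finset_le _ _).trans (Finset.sum_le_sum fun d _ => ?_)
    by_cases hd : L ≤ d
    · exact (measure_mono fun y hy => hy.2).trans (hmatch L d hd i)
    · simp [hd]
  refine (measure_mono ?_).trans ((measure_union_le _ _).trans
    (add_le_add (hunion n k) (hunion (2 * k + 1) ((k + 1) / 2))))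
  intro x hx
  obtain ⟨i, hi, ⟨d, hd, hkd, hm⟩ | ⟨d, hd, hkd, hm⟩⟩ := exists_match_of_le_Mn hk hx
  · left
    simp only [Set.mem_iUnion, Finset.mem_range]
    exact ⟨i, hi, d, hd, hkd, fun m hml => congrArg p (hm m hml)⟩
  · right
    simp only [Set.mem_iUnion, Finset.mem_range]
    exact ⟨i, hi, d, hd, hkd, fun m hml => congrArg p (hm m hml)⟩

/-- The union bound over matching positions, for matches of length `k > (log n + log log n) / β`. -/
theorem match_union_bound_le {β ε L : ℝ} {n k l : ℕ} (hn : Real.exp L = n) (hβ : 0 < β)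
    (hε : 0 < ε) (hL : 1 ≤ L) (hk : (L + Real.log L) / β < k) (hl : k ≤ 2 * l) :
    (n : ℝ) * (n * Real.exp (-(k * (2 * β + ε)))) +
      n * ((2 * k + 1 : ℕ) * Real.exp (-(l * (2 * β + ε)))) ≤ (4 / ε + 2) / L := by
  have hL0 : 0 < L := by linarith
  have hk0 : (0 : ℝ) ≤ k := Nat.cast_nonneg k
  have hl' : (k : ℝ) ≤ 2 * l := by exact_mod_cast hl
  have hq : (n : ℝ) * Real.exp (-(k * β)) ≤ 1 / L := by
    rw [div_lt_iff₀ hβ] at hk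
    calc (n : ℝ) * Real.exp (-(k * β)) ≤ n * Real.exp (-(L + Real.log L)) := by gcongr
      _ = 1 / L := by
        rw [neg_add, Real.exp_add, Real.exp_neg, Real.exp_neg, Real.exp_log hL0, hn]
        have : (n : ℝ) ≠ 0 := hn ▸ (Real.exp_pos L).ne'
        field_simp
  set q := (n : ℝ) * Real.exp (-(k * β)) with hqdef
  have hq0 : 0 ≤ q := by positivity
  have h1 : (n : ℝ) * (n * Real.exp (-(k * (2 * β + ε)))) ≤ 1 / L := by
    calc (n : ℝ) * (n * Real.exp (-(k * (2 * β + ε))))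
        ≤ n * (n * Real.exp (-(k * β) + -(k * β))) := by
          gcongr
          nlinarith
      _ = q * q := by
          rw [Real.exp_add, hqdef]
          ring
      _ ≤ 1 / L * 1 := by
          gcongr
          exact hq.trans ((div_le_one hL0).2 hL)
      _ = 1 / L := mul_one _
  have h2 : ((2 * k + 1 : ℕ) : ℝ) * Real.exp (-(k * ε / 2)) ≤ 4 / ε + 1 := by
    have he := Real.add_one_le_exp (k * ε / 2)
    have hke : 0 ≤ k * ε / 2 := by positivity
    rw [Real.exp_neg, ← div_eq_mul_inv, div_le_iff₀ (Real.exp_pos _)]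
    calc ((2 * k + 1 : ℕ) : ℝ) ≤ (4 / ε + 1) * (k * ε / 2 + 1) := by
          push_cast
          have : (4 / ε + 1) * (k * ε / 2 + 1) = 2 * k + 1 + (4 / ε + k * ε / 2) := by
            field_simp
            ring
          rw [this]
          have : 0 < 4 / ε := by positivity
          linarith
      _ ≤ _ := by gcongr
  have h3 : (n : ℝ) * ((2 * k + 1 : ℕ) * Real.exp (-(l * (2 * β + ε)))) ≤ (4 / ε + 1) * (1 / L) := by
    calc (n : ℝ) * ((2 * k + 1 : ℕ) * Real.exp (-(l * (2 * β + ε))))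
        ≤ n * ((2 * k + 1 : ℕ) * Real.exp (-(k * ε / 2) + -(k * β))) := by
          gcongr
          nlinarith
      _ = ((2 * k + 1 : ℕ) * Real.exp (-(k * ε / 2))) * q := by
          rw [Real.exp_add, hqdef]
          ring
      _ ≤ _ := by gcongr
  calc _ ≤ 1 / L + (4 / ε + 1) * (1 / L) := add_le_add h1 h3
    _ = _ := by ring

/-- In the Gibbs setting with `α = H₂(μ)/2 > 0`, for every
`ε ∈ (0, α)`, setting `r_n = (log n + log log n)/(α - ε)`, there is `K₁ > 0` with
`μ({M_n > r_n}) ≤ K₁ / log n` for all sufficiently large `n`. -/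
theorem short_match_tail_upper
    {I : Type} [Countable I] [MeasurableSpace I]
    (A : I → I → Bool) (φ : SeqSp I → ℝ) (μ : Measure (SeqSp I))
    [IsProbabilityMeasure μ]
    (hmix : TopMixing A) (hbip : BIP A) (hholder : LocallyHolder A φ)
    (hPGfin : ∃ PG : ℝ, HasGurevichPressure A φ PG)
    (hinv : MeasurePreserving (shift : SeqSp I → SeqSp I) μ μ)
    (hsupp : μ (SigmaA A) = 1)
    (hgibbs : IsGibbs A φ μ)
    (H₂ : ℝ) (hH₂ : HasRenyi A μ H₂) (hpos : 0 < H₂ / 2)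
    (ε : ℝ) (hε : 0 < ε) (hεα : ε < H₂ / 2) :
    ∃ K₁ > (0 : ℝ), ∀ᶠ n : ℕ in atTop,
      (μ {x : SeqSp I |
          (Real.log (n : ℝ) + Real.log (Real.log (n : ℝ))) / (H₂ / 2 - ε)
            < (Mn n x : ℝ)}).toReal ≤ K₁ / Real.log (n : ℝ) := by
  obtain ⟨J, _, _, _, p, C, h⟩ := hgibbs.exists_quasiBernoulli hinv hsupp
  obtain ⟨S, hbip⟩ := hbip
  have hS : ∀ a, ∃ z ∈ SigmaA A, z 0 ∈ S ∧ A a (z 0) = true := by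
    intro a
    obtain ⟨_, _, b, hb, x, hx, _, hx1, hx2⟩ := hbip a
    refine ⟨shift^[2] x, shift_iterate_mem hx 2, ?_, ?_⟩
    · rw [shift_iterate_apply, zero_add, hx2]
      exact hb
    · rw [shift_iterate_apply, ← hx1]
      exact hx 1
  set β := H₂ / 2 - ε with hβ
  have hβ0 : 0 < β := by linarith
  obtain ⟨k₀, hk₀⟩ := eventually_atTop.1
    (hH₂.eventually_tsum_le (h := 2 * β + ε) (by linarith) (by linarith))
  have hfin : ∀ j, {a | p a = j}.Finite := h.finite_fiber hS (m := k₀)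
    (ne_top_of_le_ne_top ENNReal.ofReal_ne_top (hk₀ (k₀ + 2) (by omega)))
  obtain ⟨K, hK, hbound⟩ := h.exists_measure_le_Mn hS hfin
  refine ⟨K.toReal * (4 / ε + 2) + 1, by positivity, ?_⟩
  have hlog : Tendsto (fun n : ℕ => Real.log n) atTop atTop :=
    Real.tendsto_log_atTop.comp tendsto_natCast_atTop_atTop
  filter_upwards [hlog.eventually_ge_atTop 1, hlog.eventually_ge_atTop (2 * k₀ * β),
    eventually_gt_atTop 0] with n hn1 hn2 hn0
  set L := Real.log n with hL
  set r := (L + Real.log L) / β with hr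
  have hr0 : 2 * (k₀ : ℝ) ≤ r := by
    rw [hr, le_div_iff₀ hβ0]
    have := Real.log_nonneg hn1
    linarith
  set k := ⌊r⌋₊ + 1 with hk
  have hrk : r < k := by
    rw [hk]
    exact_mod_cast Nat.lt_floor_add_one r
  have hkk : 2 * k₀ < k := by exact_mod_cast hr0.trans_lt hrk
  have hexp : Real.exp L = n := Real.exp_log (by exact_mod_cast hn0)
  have hreal := match_union_bound_le (l := (k + 1) / 2) hexp hβ0 hε hn1 hrk (by omega)
  have hle : μ {x : SeqSp I | r < (Mn n x : ℝ)} ≤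
      ENNReal.ofReal (K.toReal * ((4 / ε + 2) / L)) := by
    calc _ ≤ μ {x | k ≤ Mn n x} := by
          refine measure_mono fun x hx => ?_
          exact (Nat.floor_lt (by linarith [Nat.cast_nonneg (α := ℝ) k₀])).2 hx
      _ ≤ _ := hbound n k (by omega)
      _ ≤ n * (n * (K * ENNReal.ofReal (Real.exp (-(k * (2 * β + ε)))))) +
          n * ((2 * k + 1 : ℕ) * (K * ENNReal.ofReal
            (Real.exp (-(((k + 1) / 2 : ℕ) * (2 * β + ε)))))) := by
          gcongr
          · exact hk₀ k (by omega)
          · exact hk₀ ((k + 1) / 2) (by omega)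
      _ = ENNReal.ofReal (K.toReal * ((n : ℝ) * (n * Real.exp (-(k * (2 * β + ε)))) +
          n * ((2 * k + 1 : ℕ) * Real.exp (-(((k + 1) / 2 : ℕ) * (2 * β + ε)))))) := by
          rw [ENNReal.ofReal_mul ENNReal.toReal_nonneg, ENNReal.ofReal_toReal hK,
            ENNReal.ofReal_add (by positivity) (by positivity)]
          simp only [ENNReal.ofReal_mul (Nat.cast_nonneg _), ENNReal.ofReal_natCast]
          ring
      _ ≤ _ := ENNReal.ofReal_le_ofReal (by gcongr)
  refine (ENNReal.toReal_le_of_le_ofReal (by positivity) hle).trans ?_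
  rw [← mul_div_assoc]
  gcongr
  linarith
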